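/- (Brègman–Minc inequality.) Let A = [a_{ij}] be an n×n (0,1)-matrix whose i-th row sum is r_i, and suppose every r_i ≥ 1. Then per A ≤ ∏_{i=1}^n (r_i!)^{1/r_i}, where the powers are real powers; equality holds if and only if there exist permutation matrices P and Q such that PAQ is a block-diagonal direct sum of all-ones square matrices. -/

import Mathlib

open scoped BigOperators

namespace BGM

/-- The permanent of a square matrix with natural number entries. -/
def perm {n : ℕ} (M : Matrix (Fin n) (Fin n) ℕ) : ℕ :=
  ∑ φ : Equiv.Perm (Fin n), ∏ i, M i (φ i)

/-- `M` is a (0,1)-matrix. -/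
def IsZeroOne {n : ℕ} (M : Matrix (Fin n) (Fin n) ℕ) : Prop :=
  ∀ i j, M i j = 0 ∨ M i j = 1

/-- The number of entries of `M` equal to `0`. -/
def zeroCount {n : ℕ} (M : Matrix (Fin n) (Fin n) ℕ) : ℕ :=
  (Finset.univ.filter fun p : Fin n × Fin n => M p.1 p.2 = 0).card

/-- `𝒰(n, τ)`: the n×n (0,1)-matrices with exactly τ zero entries. -/
def Uclass (n τ : ℕ) : Set (Matrix (Fin n) (Fin n) ℕ) :=
  {M | IsZeroOne M ∧ zeroCount M = τ}

/-- `μ(n, τ) = max {per A : A ∈ 𝒰(n, τ)}`. -/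
noncomputable def mu (n τ : ℕ) : ℕ :=
  sSup (perm '' Uclass n τ)

/-- `𝒜(n, k)`: the n×n (0,1)-matrices with exactly k ones in each row and column. -/
def Aclass (n k : ℕ) : Set (Matrix (Fin n) (Fin n) ℕ) :=
  {M | IsZeroOne M ∧ (∀ i, ∑ j, M i j = k) ∧ (∀ j, ∑ i, M i j = k)}

/-- `P` is a permutation matrix. -/
def IsPermMatrix {n : ℕ} (P : Matrix (Fin n) (Fin n) ℕ) : Prop :=
  ∃ e : Equiv.Perm (Fin n), ∀ i j, P i j = if j = e i then 1 else 0

/-- `A` and `B` are combinatorially equivalent: `B = PAQ` or `B = PAᵀQ` for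
permutation matrices `P`, `Q`. -/
def CombEquiv {n : ℕ} (A B : Matrix (Fin n) (Fin n) ℕ) : Prop :=
  ∃ P Q, IsPermMatrix P ∧ IsPermMatrix Q ∧ (B = P * A * Q ∨ B = P * A.transpose * Q)

/-- Index of the block (of consecutive sizes `L`) containing position `i`. -/
def blockIdx : List ℕ → ℕ → ℕ
  | [], _ => 0
  | s :: L, i => if i < s then 0 else blockIdx L (i - s) + 1

/-- The n×n block-diagonal direct sum of all-ones blocks of sizes `L`
(with `L.sum = n`). -/
def listBlocks (n : ℕ) (L : List ℕ) : Matrix (Fin n) (Fin n) ℕ :=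
  Matrix.of fun i j => if blockIdx L (i : ℕ) = blockIdx L (j : ℕ) then 1 else 0

/-- The n×n block-diagonal matrix with a head block `B` (of size `m`) followed by
all-ones blocks of sizes `L` (with `m + L.sum = n`). -/
def headBlocks (n : ℕ) {m : ℕ} (B : Matrix (Fin m) (Fin m) ℕ) (L : List ℕ) :
    Matrix (Fin n) (Fin n) ℕ :=
  Matrix.of fun i j =>
    if h : (i : ℕ) < m ∧ (j : ℕ) < m then B ⟨(i : ℕ), h.1⟩ ⟨(j : ℕ), h.2⟩
    else if m ≤ (i : ℕ) ∧ m ≤ (j : ℕ) ∧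
        blockIdx L ((i : ℕ) - m) = blockIdx L ((j : ℕ) - m) then 1 else 0

/-- `M` with the `(i0, j0)` entry changed to `1`. -/
def setOne {n : ℕ} (M : Matrix (Fin n) (Fin n) ℕ) (i0 j0 : Fin n) :
    Matrix (Fin n) (Fin n) ℕ :=
  Matrix.of fun i j => if i = i0 ∧ j = j0 then 1 else M i j

/-- `J₃ - I₃`. -/
def J3mI3 : Matrix (Fin 3) (Fin 3) ℕ := Matrix.of fun i j => if i = j then 0 else 1

/-- `J₄ - I₄`. -/
def J4mI4 : Matrix (Fin 4) (Fin 4) ℕ := Matrix.of fun i j => if i = j then 0 else 1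

/-- `A₃`: the 3×3 all-ones matrix except the (1,1) entry is 0. -/
def A3 : Matrix (Fin 3) (Fin 3) ℕ := Matrix.of fun i j => if i = 0 ∧ j = 0 then 0 else 1

/-- `A₃ ⊕ I₂`. -/
def V5 : Matrix (Fin 5) (Fin 5) ℕ :=
  !![0,1,1,0,0; 1,1,1,0,0; 1,1,1,0,0; 0,0,0,1,0; 0,0,0,0,1]

/-- `J₃ ⊕ I₂`. -/
def S5 : Matrix (Fin 5) (Fin 5) ℕ :=
  !![1,1,1,0,0; 1,1,1,0,0; 1,1,1,0,0; 0,0,0,1,0; 0,0,0,0,1]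

/-- The head block of `W`. -/
def BW : Matrix (Fin 4) (Fin 4) ℕ :=
  !![0,0,1,1; 1,1,0,1; 1,1,1,0; 1,1,0,1]

/-- The head block of `X`. -/
def BX : Matrix (Fin 4) (Fin 4) ℕ :=
  !![0,0,1,1; 1,0,1,1; 1,1,0,1; 1,1,1,0]

/-- The head block of `Y`. -/
def BY : Matrix (Fin 4) (Fin 4) ℕ :=
  !![0,0,1,1; 1,0,1,1; 1,1,0,0; 1,1,1,1]

/-- `A₃ ⊕ I₁`. -/
def T4 : Matrix (Fin 4) (Fin 4) ℕ :=
  !![0,1,1,0; 1,1,1,0; 1,1,1,0; 0,0,0,1]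

/-- `A₄ ⊕ J₂`, where `A₄` is `J₄` with the (1,1) entry changed to 0. -/
def Q6 : Matrix (Fin 6) (Fin 6) ℕ :=
  !![0,1,1,1,0,0; 1,1,1,1,0,0; 1,1,1,1,0,0; 1,1,1,1,0,0; 0,0,0,0,1,1; 0,0,0,0,1,1]

/-- `J₃ ⊕ I₁`. -/
def M4 : Matrix (Fin 4) (Fin 4) ℕ :=
  !![1,1,1,0; 1,1,1,0; 1,1,1,0; 0,0,0,1]

open Classical in
/-- permutations supported by the relation `a` -/
noncomputable def SS {α : Type*} [Fintype α] [DecidableEq α] (a : α → α → Prop) :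
    Finset (Equiv.Perm α) :=
  Finset.univ.filter fun σ => ∀ i, a i (σ i)

open Classical in
/-- row sums -/
noncomputable def rs {α : Type*} [Fintype α] (a : α → α → Prop) (i : α) : ℕ :=
  (Finset.univ.filter fun k => a i k).card

/-- delete row `i`, column `k`, keeping the entry `(i,k)` as an isolated one -/
def del {α : Type*} (a : α → α → Prop) (i k : α) : α → α → Prop :=
  fun j c => (j = i ∧ c = k) ∨ (j ≠ i ∧ c ≠ k ∧ a j c)

/-- rows equal or disjoint -/
def Blk {α : Type*} (a : α → α → Prop) : Prop :=
  ∀ p q k l, a p k → a q k → a p l → a q l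

/-- rows off `T` are isolated -/
def Iso {α : Type*} (T : Finset α) (a : α → α → Prop) : Prop :=
  ∀ i, i ∉ T → ∀ k, a i k → (∀ j, a j k → j = i) ∧ (∀ k', a i k' → k' = k)

/-- logarithm of the factor -/
noncomputable def ell (r : ℕ) : ℝ := Real.log (r.factorial : ℝ) / r

section
variable {α : Type*} [Fintype α] [DecidableEq α]

lemma mem_SS {a : α → α → Prop} {σ : Equiv.Perm α} : σ ∈ SS a ↔ ∀ i, a i (σ i) := by
  simp [SS]

lemma mem_SS_del {a : α → α → Prop} {i k : α} (h : a i k) {σ : Equiv.Perm α} :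
    σ ∈ SS (del a i k) ↔ σ ∈ SS a ∧ σ i = k := by
  simp only [mem_SS, del]
  constructor
  · intro H
    have hi : σ i = k := by
      rcases H i with h1 | h1
      · exact h1.2
      · exact absurd rfl h1.1
    refine ⟨fun j => ?_, hi⟩
    rcases H j with h1 | h1
    · rw [h1.1, hi]; exact h
    · exact h1.2.2
  · rintro ⟨H, hi⟩ j
    by_cases hj : j = i
    · left; exact ⟨hj, by rw [hj, hi]⟩
    · right
      exact ⟨hj, fun e => hj (σ.injective (e.trans hi.symm)), H j⟩

lemma SS_del {a : α → α → Prop} {i k : α} (h : a i k) :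
    SS (del a i k) = (SS a).filter (fun σ => σ i = k) := by
  ext σ
  rw [mem_SS_del h, Finset.mem_filter]

lemma Iso_del {T : Finset α} {a : α → α → Prop} (hI : Iso T a) {i k : α} (h : a i k) :
    Iso (T.erase i) (del a i k) := by
  intro i' hi' c hc
  unfold del at *
  by_cases e : i' = i
  · subst e
    have : c = k := by grind
    subst this
    constructor <;> grind
  · have hT : i' ∉ T := by grind
    have := hI i' hT
    constructor <;> grind

/-- Blocks: every one extends. -/
lemma extend {a : α → α → Prop} (hB : Blk a) {σ : Equiv.Perm α} (hσ : σ ∈ SS a) {q k : α}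
    (h : a q k) : ∃ τ ∈ SS a, τ q = k := by
  rw [mem_SS] at hσ
  refine ⟨σ * Equiv.swap q (σ.symm k), ?_, by simp⟩
  rw [mem_SS]
  intro i
  have h2 : a (σ.symm k) k := by simpa using hσ (σ.symm k)
  simp only [Equiv.Perm.mul_apply, Equiv.swap_apply_def]
  split_ifs with h1 h3
  · subst h1; simpa using h
  · subst h3
    exact hB q _ k _ h h2 (hσ q)
  · exact hσ i

lemma Blk_del {a : α → α → Prop} (hB : Blk a) (i k : α) : Blk (del a i k) := by
  intro p q c l h1 h2 h3
  unfold del at *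
  have := hB p q c l
  grind

/-- swap columns: fibres have equal size. -/
lemma fib_eq {a : α → α → Prop} (hB : Blk a) {i k k' : α} (h : a i k) (h' : a i k') :
    ((SS a).filter (fun σ => σ i = k)).card = ((SS a).filter (fun σ => σ i = k')).card := by
  have key : ∀ k k', a i k → a i k' → ∀ σ ∈ SS a, Equiv.swap k k' * σ ∈ SS a := by
    intro k k' h h' σ hσ
    rw [mem_SS] at *
    intro j
    have := hσ j
    simp only [Equiv.Perm.mul_apply, Equiv.swap_apply_def]
    split_ifs with h1 h3
    · rw [h1] at this; exact hB i j k k' h this h'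
    · rw [h3] at this; exact hB i j k' k h' this h
    · exact this
  refine Finset.card_bij' (fun σ _ => Equiv.swap k k' * σ) (fun σ _ => Equiv.swap k k' * σ)
    ?_ ?_ ?_ ?_
  · intro σ hσ
    rw [Finset.mem_filter] at *
    exact ⟨key k k' h h' σ hσ.1, by simp [hσ.2]⟩
  · intro σ hσ
    rw [Finset.mem_filter] at *
    exact ⟨key k k' h h' σ hσ.1, by simp [hσ.2]⟩
  · intro σ _; simp [← mul_assoc]
  · intro σ _; simp [← mul_assoc]

/-- Abstract Jensen-type inequality. -/
lemma jen {ι β : Type*} [DecidableEq β] (S : Finset ι) (hS : S.Nonempty) (f : ι → β)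
    (K : Finset β) (hf : ∀ s ∈ S, f s ∈ K) :
    ∑ s ∈ S, (Real.log S.card - Real.log K.card
      - Real.log ((S.filter (fun t => f t = f s)).card)) ≤ 0 ∧
    (∑ s ∈ S, (Real.log S.card - Real.log K.card
      - Real.log ((S.filter (fun t => f t = f s)).card)) = 0 → ∀ k ∈ K, ∃ s ∈ S, f s = k) := by
  have hSp : (0:ℝ) < S.card := by exact_mod_cast hS.card_pos
  obtain ⟨s0, hs0⟩ := hS
  have hKp : (0:ℝ) < K.card := by exact_mod_cast Finset.card_pos.2 ⟨_, hf s0 hs0⟩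
  have hFp : ∀ s ∈ S, (0:ℝ) < (S.filter (fun t => f t = f s)).card := by
    intro s hs
    exact_mod_cast Finset.card_pos.2 ⟨s, by simp [hs]⟩
  have h1 : ∑ s ∈ S, (Real.log S.card - Real.log K.card
      - Real.log ((S.filter (fun t => f t = f s)).card)) ≤
      ∑ s ∈ S, ((S.card : ℝ) / K.card * ((S.filter (fun t => f t = f s)).card : ℝ)⁻¹ - 1) := by
    apply Finset.sum_le_sum
    intro s hs
    have := hFp s hs
    rw [← Real.log_div hSp.ne' hKp.ne', ← Real.log_div (by positivity) this.ne', ← div_eq_mul_inv]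
    exact Real.log_le_sub_one_of_pos (by positivity)
  have h2 : ∑ s ∈ S, ((S.filter (fun t => f t = f s)).card : ℝ)⁻¹ = (S.image f).card := by
    rw [← Finset.sum_fiberwise_of_maps_to (g := f) (t := S.image f)
      (fun s hs => Finset.mem_image_of_mem f hs)]
    rw [Finset.card_eq_sum_ones, Nat.cast_sum]
    apply Finset.sum_congr rfl
    intro k hk
    obtain ⟨s, hs, rfl⟩ := Finset.mem_image.1 hk
    have : ∀ x ∈ S.filter (fun t => f t = f s),
      ((S.filter (fun t => f t = f x)).card : ℝ)⁻¹ = ((S.filter (fun t => f t = f s)).card : ℝ)⁻¹ := by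
      intro x hx
      rw [(Finset.mem_filter.1 hx).2]
    rw [Finset.sum_congr rfl this, Finset.sum_const, nsmul_eq_mul, mul_inv_cancel₀ (hFp s hs).ne']
    simp
  have h3 : ∑ s ∈ S, ((S.card : ℝ) / K.card * ((S.filter (fun t => f t = f s)).card : ℝ)⁻¹ - 1)
      = (S.card : ℝ) / K.card * ((S.image f).card - K.card) := by
    rw [Finset.sum_sub_distrib, ← Finset.mul_sum, h2]
    simp
    field_simp
  have hsub : S.image f ⊆ K := by
    intro k hk
    obtain ⟨s, hs, rfl⟩ := Finset.mem_image.1 hk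
    exact hf s hs
  have h4 : ((S.image f).card : ℝ) ≤ K.card := by exact_mod_cast Finset.card_le_card hsub
  have hq : (0:ℝ) < (S.card : ℝ) / K.card := by positivity
  rw [h3] at h1
  constructor
  · nlinarith
  · intro h0 k hk
    rw [h0] at h1
    have h5 : (K.card : ℝ) ≤ (S.image f).card := by
      by_contra hc
      push Not at hc
      nlinarith
    have h6 : S.image f = K := Finset.eq_of_subset_of_card_le hsub (by exact_mod_cast h5)
    rw [← h6] at hk
    exact Finset.mem_image.1 hk

lemma mul_ell (r : ℕ) : (r : ℝ) * ell r = Real.log (r.factorial : ℝ) := by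
  unfold ell
  rcases Nat.eq_zero_or_pos r with h | h
  · subst h; simp
  · field_simp

lemma ell_one : ell 1 = 0 := by simp [ell]

lemma rs_del_self (a : α → α → Prop) (i k : α) : rs (del a i k) i = 1 := by
  unfold rs
  rw [Finset.card_eq_one]
  refine ⟨k, ?_⟩
  ext c
  simp [del]

lemma rs_del_of {a : α → α → Prop} {i j k : α} (hj : j ≠ i) (h : a j k) :
    rs (del a i k) j = rs a j - 1 := by
  classical
  unfold rs
  rw [← Finset.card_erase_of_mem (a := k) (by simpa using h)]
  congr 1
  ext c
  simp [del, hj]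

lemma rs_del_of_not {a : α → α → Prop} {i j k : α} (hj : j ≠ i) (h : ¬ a j k) :
    rs (del a i k) j = rs a j := by
  classical
  unfold rs
  congr 1
  ext c
  simp only [del, hj, Finset.mem_filter, Finset.mem_univ, true_and]
  grind

lemma rs_iso {T : Finset α} {a : α → α → Prop} (hI : Iso T a) {i k : α} (hi : i ∉ T)
    (h : a i k) : rs a i = 1 := by
  unfold rs
  rw [Finset.card_eq_one]
  refine ⟨k, ?_⟩
  ext c
  simp only [Finset.mem_filter, Finset.mem_univ, true_and, Finset.mem_singleton]
  exact ⟨fun hc => (hI i hi k h).2 c hc, fun e => e ▸ h⟩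

lemma B_eq {T : Finset α} {a : α → α → Prop} (hI : Iso T a) {σ : Equiv.Perm α} (hσ : σ ∈ SS a) :
    ∑ j, ell (rs a j) = ∑ j ∈ T, ell (rs a j) := by
  symm
  apply Finset.sum_subset (Finset.subset_univ T)
  intro j _ hj
  rw [rs_iso hI hj (mem_SS.1 hσ j), ell_one]

/-- The counting identity. -/
lemma ident {T : Finset α} {a : α → α → Prop} (hI : Iso T a) {σ : Equiv.Perm α}
    (hσ : σ ∈ SS a) :
    ∑ i ∈ T, ∑ j, ell (rs (del a i (σ i)) j)
      = T.card * ∑ j, ell (rs a j) - ∑ j ∈ T, Real.log (rs a j) := by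
  classical
  have hs := mem_SS.1 hσ
  have h1 : ∀ i ∈ T, ∑ j, ell (rs (del a i (σ i)) j)
      = ∑ j ∈ T, ell (rs (del a i (σ i)) j) := by
    intro i hi
    rw [B_eq (Iso_del hI (hs i)) ((mem_SS_del (hs i)).2 ⟨hσ, rfl⟩)]
    apply Finset.sum_subset (Finset.erase_subset i T)
    intro j hj hj'
    have : j = i := by grind
    subst this
    rw [rs_del_self, ell_one]
  rw [Finset.sum_congr rfl h1, Finset.sum_comm, B_eq hI hσ, Finset.mul_sum,
    ← Finset.sum_sub_distrib]
  apply Finset.sum_congr rfl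
  intro j hj
  have hrow : (T.filter (fun i => a j (σ i))).card = rs a j := by
    unfold rs
    refine Finset.card_bij (fun i _ => σ i) ?_ ?_ ?_
    · intro i hi; simpa using (Finset.mem_filter.1 hi).2
    · intro x _ y _ h; exact σ.injective h
    · intro k hk
      have hk : a j k := by simpa using hk
      refine ⟨σ.symm k, ?_, by simp⟩
      rw [Finset.mem_filter]
      refine ⟨?_, by simpa using hk⟩
      by_contra hc
      have hh := hs (σ.symm k)
      rw [Equiv.apply_symm_apply] at hh
      have := (hI _ hc k hh).1 j hk
      exact hc (this ▸ hj)
  have hpos : 1 ≤ rs a j := by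
    rw [← hrow]
    exact Finset.card_pos.2 ⟨j, by simp [hj, hs j]⟩
  have hle : rs a j ≤ T.card := by
    rw [← hrow]; exact Finset.card_filter_le _ _
  have hterm : ∀ i ∈ T.erase j, ell (rs (del a i (σ i)) j) =
      if a j (σ i) then ell (rs a j - 1) else ell (rs a j) := by
    intro i hi
    have hne : j ≠ i := (Finset.ne_of_mem_erase hi).symm
    split_ifs with h
    · rw [rs_del_of hne h]
    · rw [rs_del_of_not hne h]
  rw [← Finset.add_sum_erase _ _ hj, rs_del_self, ell_one, zero_add,
    Finset.sum_congr rfl hterm, Finset.sum_ite, Finset.sum_const, Finset.sum_const]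
  have hc1 : ((T.erase j).filter (fun i => a j (σ i))).card = rs a j - 1 := by
    rw [← hrow, Finset.filter_erase, Finset.card_erase_of_mem (by simp [hj, hs j])]
  have hc2 : ((T.erase j).filter (fun i => ¬ a j (σ i))).card = T.card - rs a j := by
    have := Finset.card_filter_add_card_filter_not (s := T.erase j) (fun i => a j (σ i))
    rw [hc1, Finset.card_erase_of_mem hj] at this
    omega
  rw [hc1, hc2, nsmul_eq_mul, nsmul_eq_mul, mul_ell, Nat.cast_sub hle, sub_mul, mul_ell]
  obtain ⟨m, hm⟩ : ∃ m, rs a j = m + 1 := ⟨rs a j - 1, by omega⟩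
  rw [hm, Nat.add_sub_cancel, Nat.factorial_succ, Nat.cast_mul, Real.log_mul (by positivity)
    (by positivity)]
  ring

lemma comb {T : Finset α} {a : α → α → Prop} (hI : Iso T a)
    (hext : ∀ i ∈ T, ∀ k, a i k → ∃ σ ∈ SS a, σ i = k)
    (hblk : ∀ i ∈ T, ∀ σ ∈ SS a, Blk (del a i (σ i))) : Blk a := by
  intro p q k l hpk hqk hpl
  by_contra hql
  have hpq : p ≠ q := fun e => hql (e ▸ hpl)
  have hkl : k ≠ l := fun e => hql (e ▸ hqk)
  have hp : p ∈ T := by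
    by_contra hc
    exact hpq ((hI p hc k hpk).1 q hqk).symm
  have hq : q ∈ T := by
    by_contra hc
    exact hpq ((hI q hc k hqk).1 p hpk)
  obtain ⟨σ0, hσ0, h0⟩ := hext p hp l hpl
  have hb := hblk p hp σ0 hσ0
  rw [h0] at hb
  obtain ⟨σ, hσ, hσq⟩ := extend (q := q) (k := k) hb ((mem_SS_del hpl).2 ⟨hσ0, h0⟩)
    (Or.inr ⟨hpq.symm, hkl, hqk⟩)
  obtain ⟨hσ, hσp⟩ := (mem_SS_del hpl).1 hσ
  by_cases hi : ∃ i ∈ T, i ≠ p ∧ i ≠ q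
  · obtain ⟨i, hiT, hip, hiq⟩ := hi
    have hk : k ≠ σ i := fun e => hiq (σ.injective (e.symm.trans hσq.symm))
    have hl : l ≠ σ i := fun e => hip (σ.injective (e.symm.trans hσp.symm))
    rcases hblk i hiT σ hσ p q k l (Or.inr ⟨hip.symm, hk, hpk⟩) (Or.inr ⟨hiq.symm, hk, hqk⟩)
      (Or.inr ⟨hip.symm, hl, hpl⟩) with h | h
    · exact hl h.2
    · exact hql h.2.2
  · push Not at hi
    obtain ⟨τ, hτ, hτp⟩ := hext p hp k hpk
    have h1 := mem_SS.1 hτ (τ.symm l)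
    rw [Equiv.apply_symm_apply] at h1
    have hne : τ.symm l ≠ p := by
      intro e
      apply hkl
      rw [← hτp, ← e, Equiv.apply_symm_apply]
    have hT : τ.symm l ∈ T := by
      by_contra hc
      exact hne ((hI _ hc l h1).1 p hpl).symm
    rw [hi _ hT hne] at h1
    exact hql h1

theorem core (m : ℕ) : ∀ (T : Finset α), T.card = m → ∀ a : α → α → Prop, Iso T a →
    (SS a).Nonempty → Real.log (SS a).card ≤ ∑ j, ell (rs a j) ∧
      (Real.log (SS a).card = ∑ j, ell (rs a j) ↔ Blk a) := by
  classical
  induction m with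
  | zero =>
    intro T hT a hI hS
    rw [Finset.card_eq_zero] at hT
    subst hT
    obtain ⟨σ, hσ⟩ := hS
    have h1 : (SS a).card = 1 := by
      rw [Finset.card_eq_one]
      refine ⟨σ, ?_⟩
      ext τ
      rw [Finset.mem_singleton]
      refine ⟨fun h => ?_, fun h => h ▸ hσ⟩
      ext i
      exact (hI i (by simp) _ (mem_SS.1 hσ i)).2 _ (mem_SS.1 h i)
    have h2 : ∑ j, ell (rs a j) = 0 := by rw [B_eq hI hσ]; simp
    rw [h1, h2]
    simp only [Nat.cast_one, Real.log_one, le_refl, true_and, true_iff]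
    intro p q k l hpk hqk hpl
    rw [(hI p (by simp) k hpk).1 q hqk]; exact hpl
  | succ m ih =>
    intro T hT a hI hS
    have hmem : ∀ σ ∈ SS a, ∀ i, a i (σ i) := fun σ h => mem_SS.1 h
    have hIH : ∀ σ ∈ SS a, ∀ i ∈ T, 
        Real.log ((SS a).filter (fun τ => τ i = σ i)).card ≤ ∑ j, ell (rs (del a i (σ i)) j) ∧
        (Real.log ((SS a).filter (fun τ => τ i = σ i)).card = ∑ j, ell (rs (del a i (σ i)) j)
          ↔ Blk (del a i (σ i))) := by
      intro σ hσ i hi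
      have := ih (T.erase i) (by rw [Finset.card_erase_of_mem hi, hT]; rfl) (del a i (σ i))
        (Iso_del hI (hmem σ hσ i)) ⟨σ, (mem_SS_del (hmem σ hσ i)).2 ⟨hσ, rfl⟩⟩
      rwa [SS_del (hmem σ hσ i)] at this
    have hJ := fun i => jen (SS a) hS (fun σ => σ i) (Finset.univ.filter fun k => a i k)
      (by intro σ hσ; simpa using hmem σ hσ i)
    have hTp : (0:ℝ) < T.card := by rw [hT]; positivity
    have hNp : (0:ℝ) < (SS a).card := by exact_mod_cast hS.card_pos
    -- abbreviations
    set N : ℝ := ((SS a).card : ℝ) with hN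
    set B : ℝ := ∑ j, ell (rs a j) with hB
    let J : α → ℝ := fun i => ∑ σ ∈ SS a, (Real.log N - Real.log (rs a i)
      - Real.log ((SS a).filter (fun τ => τ i = σ i)).card)
    let D : Equiv.Perm α → α → ℝ := fun σ i =>
      Real.log ((SS a).filter (fun τ => τ i = σ i)).card - ∑ j, ell (rs (del a i (σ i)) j)
    have hJ0 : ∀ i ∈ T, J i ≤ 0 := fun i _ => (hJ i).1
    have hD0 : ∀ σ ∈ SS a, ∀ i ∈ T, D σ i ≤ 0 := fun σ hσ i hi => by
      have := (hIH σ hσ i hi).1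
      simp only [D]; linarith
    have hDs : ∀ σ ∈ SS a, ∑ i ∈ T, D σ i ≤ 0 := fun σ hσ => Finset.sum_nonpos (hD0 σ hσ)
    have key : ∑ i ∈ T, J i + ∑ σ ∈ SS a, ∑ i ∈ T, D σ i = N * (T.card * (Real.log N - B)) := by
      simp only [J]
      rw [Finset.sum_comm, ← Finset.sum_add_distrib, hN, ← nsmul_eq_mul, ← Finset.sum_const]
      apply Finset.sum_congr rfl
      intro σ hσ
      have := ident hI hσ
      simp only [D, Finset.sum_sub_distrib, this, Finset.sum_const, nsmul_eq_mul]
      ring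
    have hJs := Finset.sum_nonpos hJ0
    have hDss := Finset.sum_nonpos hDs
    refine ⟨?_, ?_, ?_⟩
    · by_contra hc
      push Not at hc
      have : 0 < N * (T.card * (Real.log N - B)) := by
        have : 0 < Real.log N - B := by linarith
        positivity
      linarith
    · intro he
      rw [he] at key
      simp only [sub_self, mul_zero] at key
      have e1 : ∑ i ∈ T, J i = 0 := by linarith
      have e2 : ∑ σ ∈ SS a, ∑ i ∈ T, D σ i = 0 := by linarith
      have e1' := (Finset.sum_eq_zero_iff_of_nonpos hJ0).1 e1
      have e2' := (Finset.sum_eq_zero_iff_of_nonpos hDs).1 e2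
      apply comb hI
      · intro i hi k hk
        exact (hJ i).2 (e1' i hi) k (by simpa using hk)
      · intro i hi σ hσ
        have := (Finset.sum_eq_zero_iff_of_nonpos (hD0 σ hσ)).1 (e2' σ hσ) i hi
        apply (hIH σ hσ i hi).2.1
        simp only [D] at this
        linarith
    · intro hBl
      have z1 : ∑ i ∈ T, J i = 0 := by
        apply Finset.sum_eq_zero
        intro i hi
        apply Finset.sum_eq_zero
        intro σ hσ
        have hc : (SS a).card = rs a i * ((SS a).filter (fun τ => τ i = σ i)).card := by
          unfold rs
          rw [Finset.card_eq_sum_card_fiberwise (f := fun τ : Equiv.Perm α => τ i)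
            (t := Finset.univ.filter fun k => a i k)]
          · rw [← smul_eq_mul, ← Finset.sum_const]
            apply Finset.sum_congr rfl
            intro k hk
            exact fib_eq hBl (by simpa using hk) (hmem σ hσ i)
          · intro τ hτ
            simpa using hmem τ hτ i
        have hne : (rs a i * ((SS a).filter (fun τ => τ i = σ i)).card) ≠ 0 := by
          rw [← hc]; exact hS.card_pos.ne'
        rw [hN, hc, Nat.cast_mul, Real.log_mul (by exact_mod_cast left_ne_zero_of_mul hne)
          (by exact_mod_cast right_ne_zero_of_mul hne)]
        ring
      have z2 : ∑ σ ∈ SS a, ∑ i ∈ T, D σ i = 0 := by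
        apply Finset.sum_eq_zero
        intro σ hσ
        apply Finset.sum_eq_zero
        intro i hi
        have := (hIH σ hσ i hi).2.2 (Blk_del hBl _ _)
        simp only [D]
        linarith
      rw [z1, z2, add_zero] at key
      have := mul_eq_zero.1 key.symm
      rcases this with h | h
      · linarith
      · rcases mul_eq_zero.1 h with h | h
        · linarith
        · linarith

theorem core' (a : α → α → Prop) (hS : (SS a).Nonempty) :
    Real.log (SS a).card ≤ ∑ j, ell (rs a j) ∧
      (Real.log (SS a).card = ∑ j, ell (rs a j) ↔ Blk a) :=
  core _ Finset.univ rfl a (fun i hi => absurd (Finset.mem_univ i) hi) hS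

end

/-- any colouring can be sorted into consecutive blocks -/
lemma sortBlocks (m : ℕ) : ∀ (β : Type) [Fintype β] (X : Type) (c : β → X), Fintype.card β = m →
    ∃ (L : List ℕ) (e : Fin L.sum ≃ β), (∀ s ∈ L, 0 < s) ∧
      ∀ i j : Fin L.sum, blockIdx L (i : ℕ) = blockIdx L (j : ℕ) ↔ c (e i) = c (e j) := by
  classical
  induction m using Nat.strong_induction_on with
  | _ m ih =>
    intro β _ X c hm
    rcases isEmpty_or_nonempty β with hE | ⟨⟨x⟩⟩
    · refine ⟨[], Equiv.equivOfIsEmpty (Fin 0) β, by simp, fun i => i.elim0⟩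
    · have hlt : Fintype.card {y // ¬ c y = c x} < m := by
        rw [← hm]
        exact Fintype.card_subtype_lt (x := x) (by simp)
      obtain ⟨L, e, hL, he⟩ := ih _ hlt {y // ¬ c y = c x} X (fun y => c y) rfl
      let s := Fintype.card {y // c y = c x}
      have hs : 0 < s := Fintype.card_pos_iff.2 ⟨⟨x, rfl⟩⟩
      let e1 : Fin s ≃ {y // c y = c x} := (Fintype.equivFin _).symm
      let E : Fin (s :: L).sum ≃ β :=
        (finCongr (List.sum_cons)).trans
          (finSumFinEquiv.symm.trans ((Equiv.sumCongr e1 e).trans (Equiv.sumCompl _)))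
      have hE : ∀ i : Fin (s :: L).sum,
          ((i : ℕ) < s ∧ c (E i) = c x) ∨
          (∃ j : Fin L.sum, (i : ℕ) = s + j ∧ E i = e j) := by
        intro i
        obtain ⟨t, rfl⟩ := ((finCongr (List.sum_cons (a := s) (l := L))).symm).surjective i
        obtain ⟨u, rfl⟩ := finSumFinEquiv.surjective t
        rcases u with u | u
        · left
          refine ⟨u.2, ?_⟩
          simp only [E, Equiv.trans_apply, Equiv.apply_symm_apply, Equiv.symm_apply_apply]
          simpa using (e1 u).2
        · right
          refine ⟨u, rfl, ?_⟩
          simp only [E, Equiv.trans_apply, Equiv.apply_symm_apply, Equiv.symm_apply_apply]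
          simp
      refine ⟨s :: L, E, ?_, ?_⟩
      · intro t ht
        rcases List.mem_cons.1 ht with h | h
        · omega
        · exact hL t h
      · intro i j
        simp only [blockIdx]
        rcases hE i with ⟨hi, hi'⟩ | ⟨i', hi, hi'⟩ <;> rcases hE j with ⟨hj, hj'⟩ | ⟨j', hj, hj'⟩
        · simp only [hi, hj, if_true, true_iff]
          exact hi'.trans hj'.symm
        · have := (e j').2
          simp only [hi, hj, hi', hj']
          simp [Ne.symm this, eq_comm]
        · have := (e i').2
          simp only [hi, hj, hi', hj']
          simp [this]
        · simp only [hi, hj, hi', hj']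
          simpa using he i' j'

lemma PAQ {n : ℕ} {A P Q : Matrix (Fin n) (Fin n) ℕ} {e f : Equiv.Perm (Fin n)}
    (hP : ∀ i j, P i j = if j = e i then 1 else 0) (hQ : ∀ i j, Q i j = if j = f i then 1 else 0)
    (i j : Fin n) : (P * A * Q) i j = A (e i) (f.symm j) := by
  rw [Matrix.mul_apply, Finset.sum_eq_single (f.symm j)]
  · rw [hQ, Matrix.mul_apply, Finset.sum_eq_single (e i)]
    · simp [hP]
    · intro b _ hb; simp [hP, hb]
    · simp
  · intro b _ hb
    rw [hQ, if_neg, mul_zero]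
    rintro rfl
    simp at hb
  · simp

lemma perm_eq {n : ℕ} {A : Matrix (Fin n) (Fin n) ℕ} (h01 : IsZeroOne A) :
    perm A = (SS (fun i j => A i j = 1)).card := by
  classical
  unfold perm SS
  rw [Finset.card_filter]
  apply Finset.sum_congr rfl
  intro φ _
  split_ifs with h
  · exact Finset.prod_eq_one (fun i _ => h i)
  · push Not at h
    obtain ⟨i, hi⟩ := h
    exact Finset.prod_eq_zero (Finset.mem_univ i) ((h01 i (φ i)).resolve_right hi)

lemma rs_eq {n : ℕ} {A : Matrix (Fin n) (Fin n) ℕ} (h01 : IsZeroOne A) (i : Fin n) :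
    ∑ j, A i j = rs (fun i j => A i j = 1) i := by
  classical
  unfold rs
  rw [Finset.card_filter]
  apply Finset.sum_congr rfl
  intro j _
  rcases h01 i j with h | h <;> simp [h]

theorem stmt14 (n : ℕ) (A : Matrix (Fin n) (Fin n) ℕ) (h01 : IsZeroOne A)
    (r : Fin n → ℕ) (hr : ∀ i, r i = ∑ j, A i j) (hpos : ∀ i, 1 ≤ r i) :
    (perm A : ℝ) ≤ ∏ i, ((r i).factorial : ℝ) ^ ((1 : ℝ) / (r i : ℝ)) ∧
    ((perm A : ℝ) = ∏ i, ((r i).factorial : ℝ) ^ ((1 : ℝ) / (r i : ℝ)) ↔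
      ∃ P Q, IsPermMatrix P ∧ IsPermMatrix Q ∧
        ∃ L : List ℕ, (∀ s ∈ L, 0 < s) ∧ L.sum = n ∧ P * A * Q = listBlocks n L) := by
  classical
  set a : Fin n → Fin n → Prop := fun i j => A i j = 1 with ha
  have hprod : ∏ i, ((r i).factorial : ℝ) ^ ((1 : ℝ) / (r i : ℝ))
      = Real.exp (∑ i, ell (rs a i)) := by
    rw [Real.exp_sum]
    apply Finset.prod_congr rfl
    intro i _
    rw [Real.rpow_def_of_pos (by positivity), hr i, rs_eq h01 i]
    congr 1
    unfold ell
    rw [mul_one_div]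
  rw [hprod, perm_eq h01]
  have hblock : (∃ P Q, IsPermMatrix P ∧ IsPermMatrix Q ∧
        ∃ L : List ℕ, (∀ s ∈ L, 0 < s) ∧ L.sum = n ∧ P * A * Q = listBlocks n L) ↔
        (SS a).Nonempty ∧ Blk a := by
    constructor
    · rintro ⟨P, Q, ⟨e, hP⟩, ⟨f, hQ⟩, L, -, -, h⟩
      have key : ∀ i j, a i j ↔ blockIdx L (e.symm i : Fin n) = blockIdx L (f j : Fin n) := by
        intro i j
        have h1 := PAQ (A := A) hP hQ (e.symm i) (f j)
        rw [h, Equiv.apply_symm_apply, Equiv.symm_apply_apply] at h1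
        simp only [ha, ← h1, listBlocks, Matrix.of_apply]
        simp
      constructor
      · refine ⟨e.symm.trans f.symm, mem_SS.2 fun i => ?_⟩
        rw [key]; simp
      · intro p q k l h1 h2 h3
        rw [key] at *
        rw [h2, ← h1, h3]
    · rintro ⟨⟨σ, hσ⟩, hB⟩
      have hs := mem_SS.1 hσ
      obtain ⟨L, e, hL, he⟩ := sortBlocks n (Fin n) (Fin n → Prop) a (by simp)
      have hn : L.sum = n := by simpa using Fintype.card_congr e
      let e' : Equiv.Perm (Fin n) := (finCongr hn.symm).trans e
      have he' : ∀ i j : Fin n, blockIdx L (i : ℕ) = blockIdx L (j : ℕ) ↔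
          a (e' i) = a (e' j) := by
        intro i j
        exact he (finCongr hn.symm i) (finCongr hn.symm j)
      let f : Equiv.Perm (Fin n) := (e'.trans σ).symm
      refine ⟨fun i j => if j = e' i then 1 else 0, fun i j => if j = f i then 1 else 0,
        ⟨e', fun _ _ => rfl⟩, ⟨f, fun _ _ => rfl⟩, L, hL, hn, ?_⟩
      ext i j
      rw [PAQ (e := e') (f := f) (fun _ _ => rfl) (fun _ _ => rfl)]
      have h1 : A (e' i) (f.symm j) = 1 ↔ blockIdx L (i : ℕ) = blockIdx L (j : ℕ) := by
        rw [he']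
        change a (e' i) (σ (e' j)) ↔ _
        constructor
        · intro h
          ext l
          exact ⟨fun h2 => hB _ _ _ _ h (hs _) h2, fun h2 => hB _ _ _ _ (hs _) h h2⟩
        · intro h
          rw [h]; exact hs _
      simp only [listBlocks, Matrix.of_apply]
      split_ifs with h
      · exact h1.2 h
      · exact (h01 _ _).resolve_right (fun h2 => h (h1.1 h2))
  rw [hblock]
  rcases (SS a).eq_empty_or_nonempty with hE | hS
  · rw [hE]
    simp only [Finset.card_empty, Nat.cast_zero, Finset.not_nonempty_empty, false_and, iff_false]
    exact ⟨(Real.exp_pos _).le, (Real.exp_pos _).ne⟩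
  · have hc := core' a hS
    have hNp : (0:ℝ) < (SS a).card := by exact_mod_cast hS.card_pos
    refine ⟨(Real.log_le_iff_le_exp hNp).1 hc.1, ?_⟩
    rw [← hc.2]
    constructor
    · intro h
      exact ⟨hS, by rw [h, Real.log_exp]⟩
    · rintro ⟨_, h⟩
      rw [← h, Real.exp_log hNp]

end BGM
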